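/- Let k ≥ 4 and let G be a k-γc-critical graph with exactly k−3 cut vertices, with γc-set D. Then every cut vertex of G lies in D, |D \ C(G)| = 3, and exactly one of the following holds: (a) some end block B of G satisfies |(D ∩ V(B)) \ C(G)| = 3 and every other block B' satisfies |(D ∩ V(B')) \ C(G)| = 0; or (b) some end block B of G satisfies |(D ∩ V(B)) \ C(G)| = 2, exactly one block B' ≠ B satisfies |(D ∩ V(B')) \ C(G)| = 1, and every remaining block contains no vertex of D outside C(G). Equivalently, with the block labelling below, G ∈ H(0, 0, …, 0, 3) or G ∈ H(b₁, …, b_{k−3}, 2) where exactly one b_i equals 1 and all other b_j equal 0. -/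

import Mathlib

variable {V : Type*}

/-- `D` is a connected dominating set of `G`: every vertex is in `D` or adjacent to a
vertex of `D`, and the subgraph induced by `D` is connected. -/
def IsCDS (G : SimpleGraph V) (D : Set V) : Prop :=
  (∀ v : V, v ∈ D ∨ ∃ u ∈ D, G.Adj u v) ∧ (G.induce D).Connected

/-- The connected domination number `γc(G)`. -/
noncomputable def connDomNum (G : SimpleGraph V) : ℕ :=
  sInf {n : ℕ | ∃ D : Set V, IsCDS G D ∧ D.ncard = n}

/-- `G + uv`: the graph `G` with the edge `uv` added. -/
def addEdge (G : SimpleGraph V) (u v : V) : SimpleGraph V :=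
  G ⊔ SimpleGraph.fromEdgeSet {s(u, v)}

/-- `G` is `k`-`γc`-critical. -/
def IsCritical (G : SimpleGraph V) (k : ℕ) : Prop :=
  connDomNum G = k ∧
  ∀ u v : V, u ≠ v → ¬ G.Adj u v → connDomNum (addEdge G u v) < k

/-- `D` is a `γc`-set of `G`: a connected dominating set of minimum size. -/
def IsGammaCSet (G : SimpleGraph V) (D : Set V) : Prop :=
  IsCDS G D ∧ D.ncard = connDomNum G

/-- `v` is a cut vertex of the connected graph `G`: `G - v` is disconnected. -/
def IsCutVertex (G : SimpleGraph V) (v : V) : Prop :=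
  G.Connected ∧ ¬ (G.induce {u : V | u ≠ v}).Connected

/-- `C(G)`: the set of cut vertices of `G`. -/
def cutVertices (G : SimpleGraph V) : Set V := {v : V | IsCutVertex G v}

/-- The induced subgraph on `B` has no cut vertex of its own. -/
def NoOwnCutVertex (G : SimpleGraph V) (B : Set V) : Prop :=
  ∀ v : B, ¬ IsCutVertex (G.induce B) v

/-- `B` is (the vertex set of) a block of `G`: a maximal connected subgraph
having no cut vertex of its own. -/
def IsBlock (G : SimpleGraph V) (B : Set V) : Prop :=
  (G.induce B).Connected ∧ NoOwnCutVertex G B ∧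
  ∀ B' : Set V, B ⊆ B' → (G.induce B').Connected → NoOwnCutVertex G B' → B' = B

theorem induce_connected_iff {G : SimpleGraph V} {S : Set V} :
    (G.induce S).Connected ↔ S.Nonempty ∧ ∀ P ⊆ S, P.Nonempty →
      (∀ a ∈ P, ∀ b ∈ S, G.Adj a b → b ∈ P) → S ⊆ P := by
  constructor
  · intro h
    refine ⟨Set.nonempty_coe_sort.1 h.nonempty, fun P hPS ⟨a, ha⟩ hP b hb => ?_⟩
    have key : ∀ u v : S, (G.induce S).Walk u v → (u : V) ∈ P → (v : V) ∈ P := by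
      intro u v p
      induction p with
      | nil => exact id
      | cons hadj _ ih => exact fun hu => ih (hP _ hu _ (Subtype.coe_prop _) hadj)
    obtain ⟨p⟩ := h.preconnected ⟨a, hPS ha⟩ ⟨b, hb⟩
    exact key _ _ p ha
  · rintro ⟨⟨a, ha⟩, h⟩
    refine (SimpleGraph.connected_iff_exists_forall_reachable _).2 ⟨⟨a, ha⟩, fun ⟨b, hb⟩ => ?_⟩
    have := h {v | ∃ hv : v ∈ S, (G.induce S).Reachable ⟨a, ha⟩ ⟨v, hv⟩}
      (fun v hv => hv.1) ⟨a, ha, SimpleGraph.Reachable.refl _⟩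
      (fun u ⟨hu, hr⟩ v hv huv => ⟨hv, hr.trans (SimpleGraph.Adj.reachable huv)⟩) hb
    exact this.2

theorem connected_iff_closed {G : SimpleGraph V} :
    G.Connected ↔ Nonempty V ∧ ∀ P : Set V, P.Nonempty →
      (∀ a ∈ P, ∀ b, G.Adj a b → b ∈ P) → ∀ v, v ∈ P := by
  rw [← (SimpleGraph.induceUnivIso G).connected_iff, induce_connected_iff]
  simp [Set.nonempty_iff_univ_nonempty, Set.subset_def]

theorem induce_insert_connected {G : SimpleGraph V} {W : Set V} {c t : V}
    (hW : (G.induce W).Connected) (hc : c ∈ W) (hct : G.Adj c t) :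
    (G.induce (insert t W)).Connected := by
  rw [induce_connected_iff] at hW ⊢
  refine ⟨⟨t, by simp⟩, fun P hP hne hcl => ?_⟩
  have hcP : c ∈ P → insert t W ⊆ P := by
    intro h
    have h1 := hW.2 (P ∩ W) Set.inter_subset_right ⟨c, h, hc⟩
      (fun a ha b hb hab => ⟨hcl a ha.1 b (Or.inr hb) hab, hb⟩)
    exact Set.insert_subset (hcl c h t (Or.inl rfl) hct) fun v hv => (h1 hv).1
  by_cases ht : t ∈ P
  · exact hcP (hcl t ht c (Or.inr hc) hct.symm)
  · have h1 := hW.2 (P ∩ W) Set.inter_subset_right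
      (by obtain ⟨a, ha⟩ := hne
          have := hP ha
          simp only [Set.mem_insert_iff] at this
          exact ⟨a, ha, this.resolve_left (fun e => ht (e ▸ ha))⟩)
      (fun a ha b hb hab => ⟨hcl a ha.1 b (Or.inr hb) hab, hb⟩)
    exact hcP (h1 hc).1

/-- Removing a vertex inside an induced subgraph. -/
theorem induce_induce_ne_connected_iff {G : SimpleGraph V} {B : Set V} {v : B} :
    ((G.induce B).induce {u : B | u ≠ v}).Connected ↔ (G.induce (B \ {v.1})).Connected := by
  rw [induce_connected_iff, induce_connected_iff]
  constructor
  · rintro ⟨⟨a, ha⟩, h⟩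
    refine ⟨⟨a, a.2, fun e => ha (Subtype.ext e)⟩, fun P hP hne hcl b hb => ?_⟩
    refine @h (Subtype.val ⁻¹' P) (fun u hu => ?_) ?_ ?_ ⟨b, hb.1⟩ ?_
    · exact fun e => (hP hu).2 (by simp [e])
    · obtain ⟨a, ha⟩ := hne
      exact ⟨⟨a, (hP ha).1⟩, ha⟩
    · exact fun a ha b hb hab => hcl _ ha _ ⟨b.2, fun e => hb (Subtype.ext e)⟩ hab
    · exact fun e => hb.2 (by simp [← e])
  · rintro ⟨⟨a, ha⟩, h⟩
    refine ⟨⟨⟨a, ha.1⟩, fun e => ha.2 (by simp [← e])⟩, fun P hP hne hcl b hb => ?_⟩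
    have := @h (Subtype.val '' P) ?_ (hne.image _) ?_ b.1 ⟨b.2, fun e => hb (Subtype.ext e)⟩
    · simpa using this
    · rintro _ ⟨u, hu, rfl⟩
      exact ⟨u.2, fun e => hP hu (Subtype.ext e)⟩
    · rintro _ ⟨u, hu, rfl⟩ w hw huw
      exact ⟨⟨w, hw.1⟩, hcl u hu _ (fun e => hw.2 (by simp [← e])) huw, rfl⟩

theorem noOwnCutVertex_iff {G : SimpleGraph V} {B : Set V} (hB : (G.induce B).Connected) :
    NoOwnCutVertex G B ↔ ∀ v ∈ B, (G.induce (B \ {v})).Connected := by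
  simp only [NoOwnCutVertex, IsCutVertex, hB, true_and, not_not, Subtype.forall]
  exact forall₂_congr fun v hv => induce_induce_ne_connected_iff

/-- `A` is a nonempty set attached to the rest of `G` only through the vertex `c`. -/
def IsPendant (G : SimpleGraph V) (A : Set V) (c : V) : Prop :=
  A.Nonempty ∧ c ∉ A ∧ ∀ a ∈ A, ∀ b, G.Adj a b → b ∈ A ∨ b = c

theorem IsPendant.isCutVertex {G : SimpleGraph V} (hG : G.Connected) {A : Set V} {c w : V}
    (hA : IsPendant G A c) (hw : w ∉ A) (hwc : w ≠ c) : IsCutVertex G c := by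
  refine ⟨hG, fun h => hw ?_⟩
  refine (induce_connected_iff.1 h).2 A (fun a ha e => hA.2.1 (e ▸ ha)) hA.1 ?_ hwc
  exact fun a ha b hb hab => (hA.2.2 a ha b hab).resolve_right hb

/-- A cut vertex splits the remaining vertices into two pendant sets. -/
theorem IsCutVertex.exists_isPendant {G : SimpleGraph V} {c w : V} (hc : IsCutVertex G c)
    (hwc : w ≠ c) :
    ∃ A A' : Set V, IsPendant G A c ∧ IsPendant G A' c ∧ Disjoint A A' ∧
      ∀ v, v ∈ A ∨ v ∈ A' ∨ v = c := by
  obtain ⟨-, hn⟩ := hc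
  rw [induce_connected_iff] at hn
  push Not at hn
  obtain ⟨P, hP, hne, hcl, hnot⟩ := hn ⟨w, hwc⟩
  obtain ⟨u, hu, huP⟩ := Set.not_subset.1 hnot
  refine ⟨P, {v | v ≠ c ∧ v ∉ P}, ⟨hne, fun h => hP h rfl, fun a ha b hab => ?_⟩,
    ⟨⟨u, hu, huP⟩, fun h => h.1 rfl, fun a ha b hab => ?_⟩, ?_, fun v => ?_⟩
  · by_cases h : b = c
    · exact Or.inr h
    · exact Or.inl (hcl a ha b h hab)
  · by_cases h : b = c
    · exact Or.inr h
    · exact Or.inl ⟨h, fun hb => ha.2 (hcl b hb a ha.1 hab.symm)⟩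
  · exact Set.disjoint_left.2 fun v hv h => h.2 hv
  · by_cases v = c <;> by_cases v ∈ P <;> simp_all

theorem IsCDS.connected {G : SimpleGraph V} {D : Set V} (h : IsCDS G D) : G.Connected := by
  obtain ⟨⟨a, ha⟩, hD⟩ := induce_connected_iff.1 h.2
  refine connected_iff_closed.2 ⟨⟨a⟩, fun P ⟨p, hp⟩ hcl v => ?_⟩
  have hne : (P ∩ D).Nonempty := by
    rcases h.1 p with hpD | ⟨u, hu, hup⟩
    · exact ⟨p, hp, hpD⟩
    · exact ⟨u, hcl p hp u hup.symm, hu⟩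
  have := hD (P ∩ D) Set.inter_subset_right hne fun a ha b hb hab => ⟨hcl a ha.1 b hab, hb⟩
  rcases h.1 v with hv | ⟨u, hu, huv⟩
  · exact (this hv).1
  · exact hcl u (this hu).1 v huv

theorem isCDS_univ {G : SimpleGraph V} (h : G.Connected) : IsCDS G Set.univ :=
  ⟨fun v => Or.inl (Set.mem_univ v), (SimpleGraph.induceUnivIso G).connected_iff.2 h⟩

theorem connDomNum_le {G : SimpleGraph V} {D : Set V} (h : IsCDS G D) :
    connDomNum G ≤ D.ncard := Nat.sInf_le ⟨D, h, rfl⟩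

theorem exists_isGammaCSet {G : SimpleGraph V} (h : G.Connected) : ∃ D, IsGammaCSet G D := by
  obtain ⟨D, hD, hn⟩ := Nat.sInf_mem (s := {n : ℕ | ∃ D : Set V, IsCDS G D ∧ D.ncard = n})
    ⟨_, Set.univ, isCDS_univ h, rfl⟩
  exact ⟨D, hD, hn⟩

/-- A connected dominating set contains every cut vertex. -/
theorem cutVertices_subset_of_isCDS {G : SimpleGraph V} {D : Set V} (hD : IsCDS G D)
    (hV : Nontrivial V) : cutVertices G ⊆ D := by
  intro c hc
  by_contra hcD
  obtain ⟨w, hw⟩ := exists_ne c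
  obtain ⟨A, A', hA, hA', hdis, hcov⟩ := IsCutVertex.exists_isPendant hc hw
  have hcon := (induce_connected_iff.1 hD.2).2
  have meet : ∀ {B}, IsPendant G B c → D ⊆ B := by
    intro B hB
    obtain ⟨b, hb⟩ := hB.1
    have hne : (B ∩ D).Nonempty := by
      rcases hD.1 b with h | ⟨u, hu, hub⟩
      · exact ⟨b, hb, h⟩
      · exact ⟨u, (hB.2.2 b hb u hub.symm).resolve_right (fun e => hcD (e ▸ hu)), hu⟩
    have := hcon (B ∩ D) Set.inter_subset_right hne fun a ha d hd had =>
      ⟨(hB.2.2 a ha.1 d had).resolve_right (fun e => hcD (e ▸ hd)), hd⟩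
    exact fun d hd => (this hd).1
  obtain ⟨⟨d, hd⟩, -⟩ := induce_connected_iff.1 hD.2
  exact Set.disjoint_left.1 hdis.symm (meet hA' hd) (meet hA hd)

/-- A dominating set `W` of a connected graph whose components all meet `{c, c'}` becomes
connected after adding at most two vertices. -/
theorem exists_connected_superset [Finite V] {G : SimpleGraph V} {c c' : V} {R W P : Set V}
    (hR : (G.induce R).Connected)
    (hWR : W ⊆ R) (hdom : ∀ v ∈ R, v ∈ W ∨ ∃ u ∈ W, G.Adj u v)
    (hPcl : ∀ a ∈ P, ∀ b ∈ W, G.Adj a b → b ∈ P) (hPW : P ⊆ W) (hcP : c ∈ P) (hc' : c' ∈ W)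
    (hc'P : c' ∉ P)
    (hmem : ∀ Y ⊆ W, Y.Nonempty → (∀ a ∈ Y, ∀ b ∈ W, G.Adj a b → b ∈ Y) → c ∈ Y ∨ c' ∈ Y) :
    ∃ W', W ⊆ W' ∧ (G.induce W').Connected ∧ W'.ncard ≤ W.ncard + 2 := by
  obtain ⟨r, r', hr, hr', hrX, hrX', hadj⟩ : ∃ r r', r ∈ R ∧ r' ∈ R ∧
      (r ∈ P ∨ ∃ u ∈ P, G.Adj u r) ∧ ¬ (r' ∈ P ∨ ∃ u ∈ P, G.Adj u r') ∧ G.Adj r r' := by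
    by_contra hcon
    push Not at hcon
    have h1 := (induce_connected_iff.1 hR).2 {r | r ∈ R ∧ (r ∈ P ∨ ∃ u ∈ P, G.Adj u r)}
      (fun v hv => hv.1) ⟨c, hWR (hPW hcP), Or.inl hcP⟩ ?_ (hWR hc')
    · rcases h1.2 with h | ⟨u, hu, huc⟩
      · exact hc'P h
      · exact hc'P (hPcl u hu c' hc' huc)
    · rintro a ⟨ha, ha'⟩ b hb hab
      refine ⟨hb, ?_⟩
      by_contra hcon'
      push Not at hcon'
      exact hcon a b ha hb ha' hcon' hab
  push Not at hrX'
  have hQ : ∃ q ∈ W, q ∉ P ∧ (q = r' ∨ G.Adj q r') := by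
    rcases hdom r' hr' with h | ⟨u, hu, hur⟩
    · exact ⟨r', h, hrX'.1, Or.inl rfl⟩
    · exact ⟨u, hu, fun h => hrX'.2 u h hur, Or.inr hur⟩
  obtain ⟨q, hqW, hqP, hqr⟩ := hQ
  obtain ⟨p, hpP, hpr⟩ : ∃ p ∈ P, p = r ∨ G.Adj p r := by
    rcases hrX with h | ⟨u, hu, hur⟩
    · exact ⟨r, h, Or.inl rfl⟩
    · exact ⟨u, hu, Or.inr hur⟩
  refine ⟨insert r (insert r' W), fun v hv => Or.inr (Or.inr hv), ?_, ?_⟩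
  · refine induce_connected_iff.2 ⟨⟨r, Or.inl rfl⟩, fun Y hY hne hcl => ?_⟩
    have hclW : ∀ a ∈ Y ∩ W, ∀ b ∈ W, G.Adj a b → b ∈ Y ∩ W :=
      fun a ha b hb hab => ⟨hcl a ha.1 b (Or.inr (Or.inr hb)) hab, hb⟩
    have hrW : r ∈ insert r (insert r' W) := Or.inl rfl
    have hrW' : r' ∈ insert r (insert r' W) := Or.inr (Or.inl rfl)
    have hpc : p ∈ Y ↔ c ∈ Y := by
      constructor
      · intro h
        rcases hmem (Y ∩ P) (fun v hv => hPW hv.2) ⟨p, h, hpP⟩ (fun a ha b hb hab =>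
          ⟨hcl a ha.1 b (Or.inr (Or.inr hb)) hab, hPcl a ha.2 b hb hab⟩) with h | h
        · exact h.1
        · exact absurd h.2 hc'P
      · intro h
        by_contra hp
        rcases hmem (P \ Y) (fun v hv => hPW hv.1) ⟨p, hpP, hp⟩ (fun a ha b hb hab =>
          ⟨hPcl a ha.1 b hb hab, fun hbY => ha.2 (hcl b hbY a (Or.inr (Or.inr (hPW ha.1)))
            hab.symm)⟩) with h' | h'
        · exact h'.2 h
        · exact hc'P h'.1
    have hqc : q ∈ Y ↔ c' ∈ Y := by
      have hQcl : ∀ a ∈ W \ P, ∀ b ∈ W, G.Adj a b → b ∈ W \ P := fun a ha b hb hab =>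
        ⟨hb, fun hbP => ha.2 (hPcl b hbP a ha.1 hab.symm)⟩
      constructor
      · intro h
        rcases hmem (Y ∩ (W \ P)) (fun v hv => hv.2.1) ⟨q, h, hqW, hqP⟩ (fun a ha b hb hab =>
          ⟨hcl a ha.1 b (Or.inr (Or.inr hb)) hab, hQcl a ha.2 b hb hab⟩) with h | h
        · exact absurd hcP h.2.2
        · exact h.1
      · intro h
        by_contra hp
        rcases hmem ((W \ P) \ Y) (fun v hv => hv.1.1) ⟨q, ⟨hqW, hqP⟩, hp⟩
          (fun a ha b hb hab => ⟨hQcl a ha.1 b hb hab, fun hbY => ha.2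
            (hcl b hbY a (Or.inr (Or.inr ha.1.1)) hab.symm)⟩) with h' | h'
        · exact h'.1.2 hcP
        · exact h'.2 h
    have hpr' : p ∈ Y ↔ r ∈ Y := by
      rcases hpr with rfl | h
      · rfl
      · exact ⟨fun hp => hcl p hp r hrW h,
          fun hp => hcl r hp p (Or.inr (Or.inr (hPW hpP))) h.symm⟩
    have hqr' : q ∈ Y ↔ r' ∈ Y := by
      rcases hqr with rfl | h
      · rfl
      · exact ⟨fun hp => hcl q hp r' hrW' h,
          fun hp => hcl r' hp q (Or.inr (Or.inr hqW)) h.symm⟩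
    have hrr : r ∈ Y ↔ r' ∈ Y := ⟨fun h => hcl r h r' hrW' hadj, fun h => hcl r' h r hrW hadj.symm⟩
    have hcY : r ∈ Y := by
      by_cases h : (Y ∩ W).Nonempty
      · rcases hmem (Y ∩ W) Set.inter_subset_right h hclW with h | h
        · exact hpr'.1 (hpc.2 h.1)
        · exact hrr.2 (hqr'.1 (hqc.2 h.1))
      · obtain ⟨a, ha⟩ := hne
        rcases hY ha with rfl | rfl | haW
        · exact ha
        · exact hrr.2 ha
        · exact absurd ⟨a, ha, haW⟩ h
    rintro v (rfl | rfl | hv)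
    · exact hcY
    · exact hrr.1 hcY
    · by_contra hvY
      rcases hmem (W \ Y) (fun v hv => hv.1) ⟨v, hv, hvY⟩ (fun a ha b hb hab =>
        ⟨hb, fun hbY => ha.2 (hcl b hbY a (Or.inr (Or.inr ha.1)) hab.symm)⟩) with h | h
      · exact h.2 (hpc.1 (hpr'.2 hcY))
      · exact h.2 (hqc.1 (hqr'.2 (hrr.1 hcY)))
  · have h1 := Set.ncard_insert_le r (insert r' W)
    have h2 := Set.ncard_insert_le r' W
    omega

/-- `T` (at most one vertex) together with `c` dominates the pendant set `A`, and `x ∈ A` is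
a vertex which is not adjacent to `c` unless `T` is empty. -/
structure IsPendantDom (G : SimpleGraph V) (A T : Set V) (c x : V) : Prop where
  pendant : IsPendant G A c
  mem : x ∈ A
  dom : (T = ∅ ∧ ∀ v ∈ A, G.Adj c v) ∨ ∃ t ∈ A, T = {t} ∧ G.Adj c t ∧ ¬ G.Adj c x ∧
    ∀ v ∈ A, v = t ∨ G.Adj t v ∨ G.Adj c v

/-- Two disjoint pendant sets of `G`, together with the graph `H` obtained from `G` by joining
a vertex of the first to a vertex of the second. -/
structure IsPendantPair (G H : SimpleGraph V) (A A' T T' : Set V) (c c' x y : V) : Prop where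
  conn : G.Connected
  left : IsPendantDom G A T c x
  right : IsPendantDom G A' T' c' y
  disj : Disjoint A A'
  notMem_right : c ∉ A'
  notMem_left : c' ∉ A
  adj : ∀ a b, H.Adj a b ↔ G.Adj a b ∨ (a = x ∧ b = y) ∨ (a = y ∧ b = x)

namespace IsPendantPair

variable {G H : SimpleGraph V} {A A' T T' S : Set V} {c c' x y : V}

theorem symm (h : IsPendantPair G H A A' T T' c c' x y) :
    IsPendantPair G H A' A T' T c' c y x where
  conn := h.conn
  left := h.right
  right := h.left
  disj := h.disj.symm
  notMem_right := h.notMem_left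
  notMem_left := h.notMem_right
  adj a b := by rw [h.adj]; tauto

theorem notMem_of_mem (h : IsPendantPair G H A A' T T' c c' x y) {v : V} (hv : v ∈ A) :
    v ∉ A' := Set.disjoint_left.1 h.disj hv

/-- The part of `G` outside the two pendant sets is connected. -/
theorem compl_connected (h : IsPendantPair G H A A' T T' c c' x y) :
    (G.induce (A ∪ A')ᶜ).Connected := by
  have hc := h.left.pendant.2.1
  have hc2 := h.notMem_right
  refine induce_connected_iff.2 ⟨⟨c, by simp [hc, hc2]⟩, fun P hP hne hcl v hv => ?_⟩
  have h1 := h.left.pendant.2.2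
  have h2 := h.right.pendant.2.2
  have key := (connected_iff_closed.1 h.conn).2
    (P ∪ {a | a ∈ A ∧ c ∈ P} ∪ {a | a ∈ A' ∧ c' ∈ P})
    (by obtain ⟨p, hp⟩ := hne; exact ⟨p, Or.inl (Or.inl hp)⟩) ?_ v
  · simp only [Set.mem_compl_iff, Set.mem_union, not_or] at hv
    simp only [Set.mem_union, Set.mem_ofPred_eq, hv, false_and, or_false] at key
    exact key
  · intro a ha b hab
    have hb := hcl a
    have h3 := fun hb => h1 b hb a hab.symm
    have h4 := fun hb => h2 b hb a hab.symm
    have h1 := h1 a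
    have h2 := h2 a
    simp only [Set.mem_compl_iff, Set.mem_union, Set.mem_ofPred_eq, Set.subset_def] at *
    grind

/-- A connected set of `H` meeting `A` and not contained in `A` leaves `A` through `c` or through
the new edge. -/
theorem exists_leave (h : IsPendantPair G H A A' T T' c c' x y) (hS : IsCDS H S) {s s' : V}
    (hs : s ∈ S) (hsA : s ∈ A) (hs' : s' ∈ S) (hsA' : s' ∉ A) :
    (c ∈ S ∧ ∃ z ∈ S, z ∈ A ∧ G.Adj z c) ∨ (x ∈ S ∧ y ∈ S) := by
  by_contra hcon
  have := (induce_connected_iff.1 hS.2).2 (S ∩ A) Set.inter_subset_left ⟨s, hs, hsA⟩ ?_ hs'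
  · exact hsA' this.2
  · intro a ha b hb hab
    have h1 := h.left.pendant.2.2 a ha.2 b
    have h2 := h.left.mem
    have h3 := h.notMem_of_mem ha.2
    have h4 := h.right.mem
    rw [h.adj] at hab
    have := ha.1
    have := ha.2
    refine ⟨hb, ?_⟩
    grind

/-- A connected set of `H` meeting `A ∪ A'` and not contained in it leaves `A ∪ A'` through `c`
or `c'`. -/
theorem exists_leave_union (h : IsPendantPair G H A A' T T' c c' x y) (hS : IsCDS H S)
    {s s' : V} (hs : s ∈ S) (hsA : s ∈ A ∪ A') (hs' : s' ∈ S) (hsA' : s' ∉ A ∪ A') :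
    (c ∈ S ∧ ∃ z ∈ S, z ∈ A ∧ G.Adj z c) ∨ (c' ∈ S ∧ ∃ z ∈ S, z ∈ A' ∧ G.Adj z c') := by
  by_contra hcon
  have := (induce_connected_iff.1 hS.2).2 (S ∩ (A ∪ A')) Set.inter_subset_left ⟨s, hs, hsA⟩
    ?_ hs'
  · exact hsA' this.2
  · intro a ha b hb hab
    have h1 := h.left.pendant.2.2 a
    have h1' := h.right.pendant.2.2 a
    have h2 := h.left.mem
    have h4 := h.right.mem
    rw [h.adj] at hab
    have := ha.1
    have := ha.2
    refine ⟨hb, ?_⟩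
    simp only [Set.mem_union] at *
    grind

theorem ncard_le_one (h : IsPendantPair G H A A' T T' c c' x y) : T.ncard ≤ 1 := by
  rcases h.left.dom with ⟨rfl, -⟩ | ⟨t, -, rfl, -⟩ <;> simp

theorem ncard_add_one_le [Finite V] (h : IsPendantPair G H A A' T T' c c' x y) (hx : x ∈ S) {z : V}
    (hz : z ∈ S) (hzA : z ∈ A) (hzc : G.Adj z c) : T.ncard + 1 ≤ (S ∩ A).ncard := by
  rcases h.left.dom with ⟨rfl, -⟩ | ⟨t, -, rfl, -, hn, -⟩
  · simp only [Set.ncard_empty, zero_add]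
    exact (Set.ncard_pos (Set.toFinite _)).2 ⟨z, hz, hzA⟩
  · have : z ≠ x := by rintro rfl; exact hn hzc.symm
    rw [Set.ncard_singleton, one_add_one_eq_two, ← Set.ncard_pair this]
    exact Set.ncard_le_ncard (by
      rintro v (rfl | rfl)
      · exact ⟨hz, hzA⟩
      · exact ⟨hx, h.left.mem⟩) (Set.toFinite _)

theorem ncard_eq [Finite V] (h : IsPendantPair G H A A' T T' c c' x y) (S : Set V) :
    S.ncard = (S \ (A ∪ A')).ncard + (S ∩ A).ncard + (S ∩ A').ncard := by
  have h1 := Set.ncard_inter_add_ncard_sdiff_eq_ncard S (A ∪ A') (Set.toFinite _)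
  rw [Set.inter_union_distrib_left, Set.ncard_union_eq
    (h.disj.mono Set.inter_subset_right Set.inter_subset_right)] at h1
  omega

/-- Outside the pendant sets, `S` together with `c` and `c'` dominates in `G`. -/
theorem dominates (h : IsPendantPair G H A A' T T' c c' x y) (hS : IsCDS H S) {v : V}
    (hv : v ∉ A ∪ A') :
    v = c ∨ v = c' ∨ v ∈ S \ (A ∪ A') ∨ ∃ u ∈ S \ (A ∪ A'), G.Adj u v := by
  have hx := h.left.mem
  have hy := h.right.mem
  have h1 := h.left.pendant.2.2
  have h2 := h.right.pendant.2.2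
  rcases hS.1 v with hvS | ⟨u, hu, huv⟩
  · exact Or.inr (Or.inr (Or.inl ⟨hvS, hv⟩))
  · rw [h.adj] at huv
    have h1 := h1 u
    have h2 := h2 u
    simp only [Set.mem_sdiff, Set.mem_union] at *
    grind

/-- A connected set containing `c` and `c'` which dominates everything outside the pendant sets
extends to a connected dominating set. -/
theorem isCDS_union (h : IsPendantPair G H A A' T T' c c' x y) {W : Set V}
    (hW : (G.induce W).Connected) (hc : c ∈ W) (hc' : c' ∈ W)
    (hdom : ∀ v, v ∉ A ∪ A' → v ∈ W ∨ ∃ u ∈ W, G.Adj u v) : IsCDS G (W ∪ T ∪ T') := by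
  refine ⟨fun v => ?_, ?_⟩
  · by_cases hv : v ∈ A ∪ A'
    · rcases hv with hv | hv
      · rcases h.left.dom with ⟨-, hd⟩ | ⟨t, -, rfl, -, -, hd⟩
        · exact Or.inr ⟨c, by simp [hc], hd v hv⟩
        · rcases hd v hv with rfl | hd | hd
          · simp
          · exact Or.inr ⟨t, by simp, hd⟩
          · exact Or.inr ⟨c, by simp [hc], hd⟩
      · rcases h.right.dom with ⟨-, hd⟩ | ⟨t, -, rfl, -, -, hd⟩
        · exact Or.inr ⟨c', by simp [hc'], hd v hv⟩
        · rcases hd v hv with rfl | hd | hd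
          · simp
          · exact Or.inr ⟨t, by simp, hd⟩
          · exact Or.inr ⟨c', by simp [hc'], hd⟩
    · rcases hdom v hv with hv | ⟨u, hu, huv⟩
      · exact Or.inl (Or.inl (Or.inl hv))
      · exact Or.inr ⟨u, Or.inl (Or.inl hu), huv⟩
  · have aux : ∀ {U B Q : Set V} {d z : V}, IsPendantDom G B Q d z → (G.induce U).Connected →
        d ∈ U → (G.induce (U ∪ Q)).Connected := by
      intro U B Q d z hB hU hd
      rcases hB.dom with ⟨rfl, -⟩ | ⟨t, -, rfl, hadj, -⟩
      · rwa [Set.union_empty]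
      · rw [Set.union_singleton]
        exact induce_insert_connected hU hd hadj
    have hcT : c' ∈ W ∪ T := Or.inl hc'
    exact aux h.right (aux h.left hW hc) hcT

/-- A part of `S` outside the pendant sets which is closed under adjacency and avoids `c`
and `c'` is everything. -/
theorem subset_of_closed (h : IsPendantPair G H A A' T T' c c' x y) (hS : IsCDS H S) {P : Set V}
    (hP : P ⊆ S \ (A ∪ A')) (hne : P.Nonempty)
    (hcl : ∀ a ∈ P, ∀ b ∈ S \ (A ∪ A'), G.Adj a b → b ∈ P) (hc : c ∉ P) (hc' : c' ∉ P) :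
    S ⊆ P := by
  refine (induce_connected_iff.1 hS.2).2 P (fun v hv => (hP hv).1) hne fun a ha b hb hab => ?_
  have h1 := h.left.pendant.2.2 b
  have h2 := h.right.pendant.2.2 b
  have h3 := h.left.mem
  have h4 := h.right.mem
  have h5 := hP ha
  have h6 := hcl a ha b
  rw [h.adj] at hab
  simp only [Set.mem_sdiff, Set.mem_union] at *
  grind [SimpleGraph.Adj.symm]

theorem mem_of_ncard_pos (h : IsPendantPair G H A A' T T' c c' x y) (hS : IsCDS H S)
    (hT : T.ncard ≠ 0) : (S ∩ A).Nonempty ∨ y ∈ S := by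
  rcases h.left.dom with ⟨rfl, -⟩ | ⟨t, -, rfl, -, hn, -⟩
  · simp at hT
  · rcases hS.1 x with hx | ⟨u, hu, hux⟩
    · exact Or.inl ⟨x, hx, h.left.mem⟩
    · rw [h.adj] at hux
      rcases hux with hux | ⟨-, e⟩ | ⟨rfl, -⟩
      · rcases h.left.pendant.2.2 x h.left.mem u hux.symm with hA | rfl
        · exact Or.inl ⟨u, hu, hA⟩
        · exact absurd hux hn
      · exact absurd (e ▸ h.left.mem) (fun hx => h.notMem_of_mem hx h.right.mem)
      · exact Or.inr hu

theorem exists_connected_of_mem_of_mem [Finite V] (h : IsPendantPair G H A A' T T' c c' x y)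
    (hS : IsCDS H S) (hc : c ∈ S) (hc' : c' ∈ S) :
    ∃ W, S \ (A ∪ A') ⊆ W ∧ c ∈ W ∧ c' ∈ W ∧ (G.induce W).Connected ∧
      W.ncard + T.ncard + T'.ncard ≤ S.ncard := by
  have hcW : c ∈ S \ (A ∪ A') := by
    have := h.left.pendant.2.1; have := h.notMem_right; simp [*]
  have hcW' : c' ∈ S \ (A ∪ A') := by
    have := h.right.pendant.2.1; have := h.notMem_left; simp [*]
  have hcard := h.ncard_eq S
  have hmem : ∀ Y ⊆ S \ (A ∪ A'), Y.Nonempty →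
      (∀ a ∈ Y, ∀ b ∈ S \ (A ∪ A'), G.Adj a b → b ∈ Y) → c ∈ Y ∨ c' ∈ Y := by
    intro Y hY hne hcl
    by_contra hcon
    push Not at hcon
    exact hcon.1 (h.subset_of_closed hS hY hne hcl hcon.1 hcon.2 hc)
  by_cases hconn : (G.induce (S \ (A ∪ A'))).Connected
  · refine ⟨_, subset_rfl, hcW, hcW', hconn, ?_⟩
    have aux : ∀ {A A' T T' : Set V} {c c' x y : V}, IsPendantPair G H A A' T T' c c' x y →
        c' ∈ S → T.ncard = 0 ∨ 1 ≤ (S ∩ A).ncard ∨ T'.ncard + 1 ≤ (S ∩ A').ncard := by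
      intro A A' T T' c c' x y h hc'
      by_cases hT : T.ncard = 0
      · exact Or.inl hT
      by_cases hne : (S ∩ A).Nonempty
      · exact Or.inr (Or.inl ((Set.ncard_pos (Set.toFinite _)).2 hne))
      · have hy := (h.mem_of_ncard_pos hS hT).resolve_left hne
        rcases h.symm.exists_leave hS hy h.right.mem hc' h.right.pendant.2.1 with
          ⟨-, z, hz, hzA, hzc⟩ | ⟨-, hx⟩
        · exact Or.inr (Or.inr (h.symm.ncard_add_one_le hy hz hzA hzc))
        · exact absurd ⟨x, hx, h.left.mem⟩ hne
    have h1 := aux h hc'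
    have h2 := aux h.symm hc
    have h3 := h.ncard_le_one
    have h4 := h.symm.ncard_le_one
    omega
  · obtain ⟨P, hPW, hPcl, hcP, hc'P⟩ : ∃ P ⊆ S \ (A ∪ A'),
        (∀ a ∈ P, ∀ b ∈ S \ (A ∪ A'), G.Adj a b → b ∈ P) ∧ c ∈ P ∧ c' ∉ P := by
      rw [induce_connected_iff] at hconn
      push Not at hconn
      obtain ⟨P, hP, hne, hcl, hnot⟩ := hconn ⟨c, hcW⟩
      have hcl' : ∀ a ∈ (S \ (A ∪ A')) \ P, ∀ b ∈ S \ (A ∪ A'), G.Adj a b →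
          b ∈ (S \ (A ∪ A')) \ P := fun a ha b hb hab =>
        ⟨hb, fun hbP => ha.2 (hcl b hbP a ha.1 hab.symm)⟩
      have h1 := hmem P hP hne hcl
      have h2 := hmem _ Set.sdiff_subset (Set.sdiff_nonempty.2 hnot) hcl'
      by_cases hcP : c ∈ P
      · exact ⟨P, hP, hcl, hcP, (h2.resolve_left fun h => h.2 hcP).2⟩
      · exact ⟨_, Set.sdiff_subset, hcl', ⟨hcW, hcP⟩, fun hc => hc.2 (h1.resolve_left hcP)⟩
    have hcon := (induce_connected_iff.1 hS.2).2
    have hxy : x ∈ S ∧ y ∈ S := by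
      by_contra hcon'
      have := hcon (P ∪ (S ∩ A)) (Set.union_subset (fun v hv => (hPW hv).1)
        Set.inter_subset_left) ⟨c, Or.inl hcP⟩ ?_ hc'
      · rcases this with h' | h'
        · exact hc'P h'
        · exact h.notMem_left h'.2
      · intro a ha b hb hab
        have h1 := h.left.pendant.2.2
        have h1a := h1 a
        have h1b := h1 b
        have h2 := h.right.pendant.2.2 b
        have h3 := h.left.mem
        have h4 := h.right.mem
        have h5 := @hPW a
        have h6 := hPcl a
        have h7 := hab
        rw [h.adj] at hab
        simp only [Set.mem_sdiff, Set.mem_union, Set.mem_inter_iff] at *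
        grind [SimpleGraph.Adj.symm]
    have hz : ∃ z ∈ S, z ∈ A ∧ G.Adj z c := by
      by_contra hcon'
      push Not at hcon'
      have := hcon ((S \ P)) Set.sdiff_subset ⟨c', hc', hc'P⟩ ?_ hc
      · exact this.2 hcP
      · intro a ha b hb hab
        refine ⟨hb, fun hbP => ?_⟩
        have h1a := h.left.pendant.2.2 a
        have h2 := h.right.pendant.2.2 a
        have h3 := h.left.mem
        have h4 := h.right.mem
        have h5 := hPW hbP
        have h6 := hPcl b hbP a
        have h7 := hcon' a
        rw [h.adj] at hab
        simp only [Set.mem_sdiff, Set.mem_union] at *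
        grind [SimpleGraph.Adj.symm]
    have hz' : ∃ z ∈ S, z ∈ A' ∧ G.Adj z c' := by
      by_contra hcon'
      push Not at hcon'
      have := hcon (P ∪ (S ∩ (A ∪ A'))) (Set.union_subset (fun v hv => (hPW hv).1)
        Set.inter_subset_left) ⟨c, Or.inl hcP⟩ ?_ hc'
      · rcases this with h' | h'
        · exact hc'P h'
        · exact hcW'.2 h'.2
      · intro a ha b hb hab
        have h1a := h.left.pendant.2.2 a
        have h2 := h.right.pendant.2.2 a
        have h3 := h.left.mem
        have h4 := h.right.mem
        have h5 := @hPW a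
        have h6 := hPcl a
        have h7 := hcon' a
        rw [h.adj] at hab
        simp only [Set.mem_sdiff, Set.mem_union, Set.mem_inter_iff] at *
        grind [SimpleGraph.Adj.symm]
    obtain ⟨z, hz, hzA, hzc⟩ := hz
    obtain ⟨z', hz', hzA', hzc'⟩ := hz'
    have h1 := h.ncard_add_one_le hxy.1 hz hzA hzc
    have h2 := h.symm.ncard_add_one_le hxy.2 hz' hzA' hzc'
    obtain ⟨W, hW, hWc, hcardW⟩ := exists_connected_superset h.compl_connected
      (fun v hv => hv.2) (fun v hv => by
        rcases h.dominates hS hv with rfl | rfl | hv | hv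
        · exact Or.inl hcW
        · exact Or.inl hcW'
        · exact Or.inl hv
        · exact Or.inr hv) hPcl hPW hcP hcW' hc'P hmem
    exact ⟨W, hW, hW hcW, hW hcW', hWc, by omega⟩

theorem exists_connected_of_notMem_of_mem [Finite V]
    (h : IsPendantPair G H A A' T T' c c' x y)
    (hS : IsCDS H S) (hc : c ∉ S) (hc' : c' ∈ S) :
    ∃ W, S \ (A ∪ A') ⊆ W ∧ c ∈ W ∧ c' ∈ W ∧ (G.induce W).Connected ∧
      W.ncard + T.ncard + T'.ncard ≤ S.ncard := by
  have hcR : c ∉ A ∪ A' := by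
    have := h.left.pendant.2.1; have := h.notMem_right; simp [*]
  have hcR' : c' ∉ A ∪ A' := by
    have := h.right.pendant.2.1; have := h.notMem_left; simp [*]
  have hcW' : c' ∈ S \ (A ∪ A') := ⟨hc', hcR'⟩
  have hcc : c ≠ c' := by rintro rfl; exact hc hc'
  have hcard := h.ncard_eq S
  have hW0 : (G.induce (S \ (A ∪ A'))).Connected := by
    refine induce_connected_iff.2 ⟨⟨c', hcW'⟩, fun P hP hne hcl => ?_⟩
    have hcP : c ∉ P := fun h => hc (hP h).1
    have hmem : c' ∈ P := by
      by_contra hcP'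
      exact hcP' (h.subset_of_closed hS hP hne hcl hcP hcP' hc')
    by_contra hnot
    obtain ⟨v, hv, hvP⟩ := Set.not_subset.1 hnot
    refine (h.subset_of_closed hS (P := (S \ (A ∪ A')) \ P) Set.sdiff_subset ⟨v, hv, hvP⟩
      (fun a ha b hb hab => ⟨hb, fun hbP => ha.2 (hcl b hbP a ha.1 hab.symm)⟩)
      (fun h => hc h.1.1) (fun h => h.2 hmem) hc').2 hmem
  have hxS : (S ∩ A).Nonempty → x ∈ S ∧ y ∈ S := by
    rintro ⟨s, hs, hsA⟩
    exact (h.exists_leave hS hs hsA hc' h.notMem_left).resolve_left fun h => hc h.1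
  have hy : y ∈ S := by
    by_cases hne : (S ∩ A).Nonempty
    · exact (hxS hne).2
    · rcases hS.1 x with hx | ⟨u, hu, hux⟩
      · exact absurd ⟨x, hx, h.left.mem⟩ hne
      · rw [h.adj] at hux
        rcases hux with hux | ⟨-, e⟩ | ⟨rfl, -⟩
        · rcases h.left.pendant.2.2 x h.left.mem u hux.symm with hA | rfl
          · exact absurd ⟨u, hu, hA⟩ hne
          · exact absurd hu hc
        · exact absurd (e ▸ h.left.mem) (fun hx => h.notMem_of_mem hx h.right.mem)
        · exact hu
  have ha : T.ncard ≤ (S ∩ A).ncard := by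
    rcases h.left.dom with ⟨rfl, -⟩ | ⟨t, htA, rfl, hct, hn, -⟩
    · simp
    · rw [Set.ncard_singleton]
      refine (Set.ncard_pos (Set.toFinite _)).2 ?_
      rcases hS.1 t with ht | ⟨u, hu, hut⟩
      · exact ⟨t, ht, htA⟩
      · rw [h.adj] at hut
        rcases hut with hut | ⟨-, e⟩ | ⟨rfl, e⟩
        · rcases h.left.pendant.2.2 t htA u hut.symm with hA | rfl
          · exact ⟨u, hu, hA⟩
          · exact absurd hu hc
        · exact absurd (e ▸ htA) (fun hx => h.notMem_of_mem hx h.right.mem)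
        · exact absurd (e ▸ hct) hn
  have ha' : T'.ncard + 1 ≤ (S ∩ A').ncard := by
    rcases h.exists_leave_union hS hy (Or.inr h.right.mem) hc' hcR' with hl |
      ⟨-, z, hz, hzA, hzc⟩
    · exact absurd hl.1 hc
    · exact h.symm.ncard_add_one_le hy hz hzA hzc
  have hxc : c ≠ x := by rintro rfl; exact hcR (Or.inl h.left.mem)
  have hyc : c ≠ y := by rintro rfl; exact hcR (Or.inr h.right.mem)
  obtain ⟨s, hs, hsc⟩ := (hS.1 c).resolve_left hc
  rw [h.adj] at hsc
  replace hsc : G.Adj s c := by simpa [hxc, hyc] using hsc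
  have hsA' : s ∉ A' := fun hsA' =>
    (h.right.pendant.2.2 s hsA' c hsc).elim (fun h => hcR (Or.inr h)) hcc
  by_cases hsA : s ∈ A
  · have hx := (hxS ⟨s, hs, hsA⟩).1
    have hcA := h.ncard_add_one_le hx hs hsA hsc
    obtain ⟨w, hwR, hcw⟩ : ∃ w ∈ (A ∪ A')ᶜ, G.Adj c w := by
      by_contra hcon
      push Not at hcon
      have := (induce_connected_iff.1 h.compl_connected).2 {c} (by simpa using hcR)
        ⟨c, rfl⟩ (fun a ha b hb hab => absurd (ha ▸ hab) (hcon b hb)) hcR'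
      exact hcc this.symm
    have hWw : (G.induce (insert w (S \ (A ∪ A')))).Connected := by
      rcases h.dominates hS hwR with rfl | rfl | hw | ⟨u, hu, huw⟩
      · exact absurd hcw (G.loopless.irrefl _)
      · rwa [Set.insert_eq_of_mem hcW']
      · rwa [Set.insert_eq_of_mem hw]
      · exact induce_insert_connected hW0 hu huw
    refine ⟨insert c (insert w (S \ (A ∪ A'))), fun v hv => Or.inr (Or.inr hv), Or.inl rfl,
      Or.inr (Or.inr hcW'), induce_insert_connected hWw (Or.inl rfl) hcw.symm, ?_⟩
    have h1 := Set.ncard_insert_le c (insert w (S \ (A ∪ A')))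
    have h2 := Set.ncard_insert_le w (S \ (A ∪ A'))
    omega
  · have hsW : s ∈ S \ (A ∪ A') := ⟨hs, by simp [hsA, hsA']⟩
    refine ⟨insert c (S \ (A ∪ A')), fun v hv => Or.inr hv, Or.inl rfl, Or.inr hcW',
      induce_insert_connected hW0 hsW hsc, ?_⟩
    have h1 := Set.ncard_insert_le c (S \ (A ∪ A'))
    omega

theorem exists_connected_of_notMem_of_notMem [Finite V]
    (h : IsPendantPair G H A A' T T' c c' x y)
    (hS : IsCDS H S) (hc : c ∉ S) (hc' : c' ∉ S) :
    ∃ W, S \ (A ∪ A') ⊆ W ∧ c ∈ W ∧ c' ∈ W ∧ (G.induce W).Connected ∧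
      (W.ncard + T.ncard + T'.ncard ≤ S.ncard ∨ W.ncard ≤ 1) := by
  have hcR : c ∉ A ∪ A' := by
    have := h.left.pendant.2.1; have := h.notMem_right; simp [*]
  have hcR' : c' ∉ A ∪ A' := by
    have := h.right.pendant.2.1; have := h.notMem_left; simp [*]
  have hxA := h.left.mem
  have hyA := h.right.mem
  have hsub : S ⊆ A ∪ A' := by
    intro s hs
    by_contra hsA
    have hsub := h.subset_of_closed hS (P := S \ (A ∪ A')) subset_rfl ⟨s, hs, hsA⟩
      (fun a ha b hb hab => hb) (fun h => hc h.1) (fun h => hc' h.1)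
    rcases hS.1 x with hx | ⟨u, hu, hux⟩
    · exact (hsub hx).2 (Or.inl hxA)
    · have huA := (hsub hu).2
      rw [h.adj] at hux
      rcases hux with hux | ⟨rfl, -⟩ | ⟨rfl, -⟩
      · rcases h.left.pendant.2.2 x hxA u hux.symm with hA | rfl
        · exact huA (Or.inl hA)
        · exact hc hu
      · exact huA (Or.inl hxA)
      · exact huA (Or.inr hyA)
  have hR : (A ∪ A')ᶜ = {c, c'} := by
    ext v
    constructor
    · intro hv
      rcases h.dominates hS hv with rfl | rfl | hv | ⟨u, hu, -⟩
      · simp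
      · simp
      · exact absurd (hsub hv.1) hv.2
      · exact absurd (hsub hu.1) hu.2
    · rintro (rfl | rfl)
      · exact hcR
      · exact hcR'
  refine ⟨{c, c'}, fun v hv => absurd (hsub hv.1) hv.2, by simp, by simp,
    hR ▸ h.compl_connected, ?_⟩
  by_cases hcc : c = c'
  · subst hcc
    simp
  left
  have aux : ∀ {A A' T T' : Set V} {c c' x y : V}, IsPendantPair G H A A' T T' c c' x y →
      c ∉ S → S ⊆ A ∪ A' → c ≠ c' → ∃ z ∈ S, z ∈ A ∧ G.Adj z c := by
    intro A A' T T' c c' x y h hc hsub hcc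
    obtain ⟨s, hs, hsc⟩ := (hS.1 c).resolve_left hc
    have hxc : c ≠ x := by rintro rfl; exact h.left.pendant.2.1 h.left.mem
    have hyc : c ≠ y := by rintro rfl; exact h.notMem_right h.right.mem
    rw [h.adj] at hsc
    replace hsc : G.Adj s c := by simpa [hxc, hyc] using hsc
    refine ⟨s, hs, (hsub hs).resolve_right fun hsA' => ?_, hsc⟩
    exact (h.right.pendant.2.2 s hsA' c hsc).elim h.notMem_right hcc
  obtain ⟨z, hz, hzA, hzc⟩ := aux h hc hsub hcc
  obtain ⟨z', hz', hzA', hzc'⟩ := aux h.symm hc' (by rwa [Set.union_comm]) (Ne.symm hcc)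
  obtain ⟨hx, hy⟩ := (h.exists_leave hS hz hzA hz' (h.symm.notMem_of_mem hzA')).resolve_left
    fun h => hc h.1
  have h1 := h.ncard_add_one_le hx hz hzA hzc
  have h2 := h.symm.ncard_add_one_le hy hz' hzA' hzc'
  have h3 := h.ncard_eq S
  have h4 := Set.ncard_pair hcc
  omega

/-- Joining two pendant sets that each need at most one dominating vertex does not lower the
connected domination number below four. -/
theorem connDomNum_le [Finite V] (h : IsPendantPair G H A A' T T' c c' x y) :
    connDomNum G ≤ max 3 (connDomNum H) := by
  have hH : H.Connected := h.conn.mono fun a b hab => (h.adj a b).2 (Or.inl hab)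
  obtain ⟨S, hS, hcard⟩ := exists_isGammaCSet hH
  obtain ⟨W, hSW, hcW, hcW', hW, hle⟩ : ∃ W, S \ (A ∪ A') ⊆ W ∧ c ∈ W ∧ c' ∈ W ∧
      (G.induce W).Connected ∧ (W.ncard + T.ncard + T'.ncard ≤ S.ncard ∨ W.ncard ≤ 1) := by
    by_cases hc : c ∈ S <;> by_cases hc' : c' ∈ S
    · obtain ⟨W, h1, h2, h3, h4, h5⟩ := h.exists_connected_of_mem_of_mem hS hc hc'
      exact ⟨W, h1, h2, h3, h4, Or.inl h5⟩
    · obtain ⟨W, h1, h2, h3, h4, h5⟩ := h.symm.exists_connected_of_notMem_of_mem hS hc' hc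
      exact ⟨W, Set.union_comm A A' ▸ h1, h3, h2, h4, Or.inl (by omega)⟩
    · obtain ⟨W, h1, h2, h3, h4, h5⟩ := h.exists_connected_of_notMem_of_mem hS hc hc'
      exact ⟨W, h1, h2, h3, h4, Or.inl h5⟩
    · exact h.exists_connected_of_notMem_of_notMem hS hc hc'
  have hcds := h.isCDS_union hW hcW hcW' fun v hv => by
    rcases h.dominates hS hv with rfl | rfl | hv | ⟨u, hu, huv⟩
    · exact Or.inl hcW
    · exact Or.inl hcW'
    · exact Or.inl (hSW hv)
    · exact Or.inr ⟨u, hSW hu, huv⟩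
  have h1 := _root_.connDomNum_le hcds
  have h2 := Set.ncard_union_le (W ∪ T) T'
  have h3 := Set.ncard_union_le W T
  have h4 := h.ncard_le_one
  have h5 := h.symm.ncard_le_one
  rw [← hcard]
  omega

end IsPendantPair

theorem exists_walk_of_induce_connected {G : SimpleGraph V} {S : Set V}
    (hS : (G.induce S).Connected) {a b : V} (ha : a ∈ S) (hb : b ∈ S) :
    ∃ p : G.Walk a b, ∀ v ∈ p.support, v ∈ S := by
  obtain ⟨p⟩ := hS.preconnected ⟨a, ha⟩ ⟨b, hb⟩
  refine ⟨p.map (SimpleGraph.Embedding.induce S).toHom, fun v hv => ?_⟩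
  have hs := p.support_map (SimpleGraph.Embedding.induce S).toHom
  obtain ⟨w, -, rfl⟩ := List.mem_map.1 ((congrArg (v ∈ ·) hs).mp hv)
  exact w.2

theorem induce_connected_of_walks {G : SimpleGraph V} {S : Set V} (hne : S.Nonempty)
    (h : ∀ a ∈ S, ∀ b ∈ S, ∃ p : G.Walk a b, ∀ v ∈ p.support, v ∈ S) :
    (G.induce S).Connected := by
  have : Nonempty S := hne.to_subtype
  refine ⟨fun ⟨a, ha⟩ ⟨b, hb⟩ => ?_⟩
  obtain ⟨p, hp⟩ := h a ha b hb
  exact ⟨p.induce S hp⟩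

/-- The vertices which no third vertex separates from `u`. -/
def blockAt (G : SimpleGraph V) (u : V) : Set V :=
  {w | ∀ z, z ≠ u → z ≠ w → ∃ p : G.Walk u w, z ∉ p.support}

theorem mem_blockAt_self (G : SimpleGraph V) (u : V) : u ∈ blockAt G u :=
  fun z hz _ => ⟨SimpleGraph.Walk.nil, by simpa using hz⟩

theorem support_subset_blockAt {G : SimpleGraph V} {u w w' : V} (hw : w ∈ blockAt G u)
    (hw' : w' ∈ blockAt G u) {p : G.Walk w w'} (hp : p.IsPath) {q : V} (hq : q ∈ p.support) :
    q ∈ blockAt G u := by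
  classical
  intro z hzu hzq
  have hdis : z ∉ (p.takeUntil q hq).support ∨ z ∉ (p.dropUntil q hq).support := by
    by_contra hcon
    push Not at hcon
    have hnd := hp.support_nodup
    rw [← p.take_spec hq, SimpleGraph.Walk.support_append, List.nodup_append] at hnd
    have hzt : z ∈ (p.dropUntil q hq).support.tail := by
      have := hcon.2
      rw [SimpleGraph.Walk.mem_support_iff] at this
      exact this.resolve_left hzq
    exact hnd.2.2 z hcon.1 z hzt rfl
  rcases hdis with hz | hz
  · obtain ⟨r, hr⟩ := hw z hzu (by rintro rfl; exact hz (SimpleGraph.Walk.start_mem_support _))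
    exact ⟨r.append (p.takeUntil q hq), by simp [SimpleGraph.Walk.mem_support_append_iff, hr, hz]⟩
  · obtain ⟨r, hr⟩ := hw' z hzu (by rintro rfl; exact hz (SimpleGraph.Walk.end_mem_support _))
    exact ⟨r.append (p.dropUntil q hq).reverse,
      by simp [SimpleGraph.Walk.mem_support_append_iff, hr, hz]⟩

theorem NoOwnCutVertex.connected_sdiff {G : SimpleGraph V} {B : Set V} (hB' : NoOwnCutVertex G B)
    (hB : (G.induce B).Connected) (z : V) :
    (G.induce (B \ {z})).Connected := by
  by_cases hzB : z ∈ B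
  · exact (noOwnCutVertex_iff hB).1 hB' z hzB
  · rwa [Set.sdiff_singleton_eq_self hzB]

theorem subset_blockAt {G : SimpleGraph V} {B : Set V} (hB : (G.induce B).Connected)
    (hB' : NoOwnCutVertex G B) {u : V} (hu : u ∈ B) : B ⊆ blockAt G u := by
  intro w hw z hzu hzw
  obtain ⟨p, hp⟩ := exists_walk_of_induce_connected (hB'.connected_sdiff hB z)
    ⟨hu, hzu.symm⟩ ⟨hw, hzw.symm⟩
  exact ⟨p, fun hz => (hp z hz).2 rfl⟩

theorem isBlock_blockAt {G : SimpleGraph V} [Nontrivial V] (hG : G.Connected) {u : V}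
    (hu : u ∉ cutVertices G) : IsBlock G (blockAt G u) := by
  classical
  have hconn : (G.induce (blockAt G u)).Connected := by
    refine induce_connected_of_walks ⟨u, mem_blockAt_self G u⟩ fun a ha b hb => ?_
    obtain ⟨p, hp⟩ := (hG.preconnected a b).exists_isPath
    exact ⟨p, fun v hv => support_subset_blockAt ha hb hp hv⟩
  have hno : NoOwnCutVertex G (blockAt G u) := by
    refine (noOwnCutVertex_iff hconn).2 fun z hz => induce_connected_of_walks ?_ ?_
    · by_cases hzu : z = u
      · obtain ⟨w, huw⟩ := hG.preconnected.exists_adj_of_nontrivial u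
        refine ⟨w, fun y hyu hyw => ⟨huw.toWalk, by simp [hyu, hyw]⟩, ?_⟩
        rw [hzu]
        exact huw.ne'
      · exact ⟨u, mem_blockAt_self G u, fun h => hzu h.symm⟩
    · rintro a ⟨ha, haz⟩ b ⟨hb, hbz⟩
      obtain ⟨p, hp⟩ : ∃ p : G.Walk a b, z ∉ p.support := by
        by_cases hzu : z = u
        · have hGu : (G.induce {v | v ≠ u}).Connected := by
            by_contra hcon
            exact hu ⟨hG, hcon⟩
          obtain ⟨p, hp⟩ := exists_walk_of_induce_connected hGu
            (fun e => haz (e.trans hzu.symm)) (fun e => hbz (e.trans hzu.symm))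
          exact ⟨p, fun h => hp z h hzu⟩
        · obtain ⟨p, hp⟩ := ha z hzu (Ne.symm haz)
          obtain ⟨q, hq⟩ := hb z hzu (Ne.symm hbz)
          exact ⟨p.reverse.append q, by simp [SimpleGraph.Walk.mem_support_append_iff, hp, hq]⟩
      refine ⟨p.bypass, fun v hv => ⟨support_subset_blockAt ha hb p.bypass_isPath hv, ?_⟩⟩
      rintro rfl
      exact hp (p.support_bypass_subset_support hv)
  refine ⟨hconn, hno, fun B hB hBc hBn => (Set.Subset.antisymm ?_ hB)⟩
  exact subset_blockAt hBc hBn (hB (mem_blockAt_self G u))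

/-- A vertex which is not a cut vertex lies in exactly one block. -/
theorem IsBlock.eq_blockAt {G : SimpleGraph V} [Nontrivial V] (hG : G.Connected) {B : Set V}
    (hB : IsBlock G B) {u : V} (hu : u ∉ cutVertices G) (huB : u ∈ B) : B = blockAt G u := by
  have h := isBlock_blockAt hG hu
  exact (hB.2.2 _ (subset_blockAt hB.1 hB.2.1 huB) h.1 h.2.1).symm

/-- Every pendant set contains, for a possibly different cut vertex, a pendant set which forms
an end block together with its cut vertex. -/
theorem IsPendant.exists_endBlock [Finite V] {G : SimpleGraph V} (hG : G.Connected)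
    {A₀ : Set V} {c₀ w : V} (hA₀ : IsPendant G A₀ c₀) (hw : w ∉ A₀) (hwc : w ≠ c₀) :
    ∃ A c, A ⊆ A₀ ∧ (c ∈ A₀ ∨ c = c₀) ∧ IsPendant G A c ∧ c ∈ cutVertices G ∧
      (∀ a ∈ A, a ∉ cutVertices G) ∧ IsBlock G (insert c A) := by
  obtain ⟨A, ⟨hA, c, hc, hAc⟩, hmin⟩ := Set.exists_min_image
    {A : Set V | A ⊆ A₀ ∧ ∃ c, (c ∈ A₀ ∨ c = c₀) ∧ IsPendant G A c} Set.ncard (Set.toFinite _)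
    ⟨A₀, subset_rfl, c₀, Or.inr rfl, hA₀⟩
  have hmin' : ∀ P d, P ⊆ A → d ∈ insert c A → IsPendant G P d → P = A := by
    intro P d hP hd hPd
    refine Set.eq_of_subset_of_ncard_le hP (hmin P ⟨hP.trans hA, d, ?_, hPd⟩) (Set.toFinite _)
    rcases hd with rfl | hd
    · exact hc
    · exact Or.inl (hA hd)
  have hclosed := (connected_iff_closed.1 hG).2
  have hcw : ∃ w, w ∉ A ∧ w ≠ c := by
    rcases hc with hc | rfl
    · exact ⟨c₀, fun h => hA₀.2.1 (hA h), fun h => hA₀.2.1 (h ▸ hc)⟩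
    · exact ⟨w, fun h => hw (hA h), hwc⟩
  obtain ⟨w, hwA, hwc⟩ := hcw
  have hconn : (G.induce (insert c A)).Connected := by
    refine induce_connected_iff.2 ⟨⟨c, Or.inl rfl⟩, fun P hP hne hcl v hv => ?_⟩
    have hcP : c ∈ P := by
      by_contra hcP
      refine hcP (hclosed P hne (fun a ha b hab => ?_) c)
      have haA : a ∈ A := (hP ha).resolve_left fun e => hcP (e ▸ ha)
      exact hcl a ha b ((hAc.2.2 a haA b hab).symm) hab
    by_contra hvP
    refine hwA (hclosed (A \ P) ⟨v, hv.resolve_left fun e => hvP (e ▸ hcP), hvP⟩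
      (fun a ha b hab => ?_) w).1
    have hb : b ∈ insert c A := (hAc.2.2 a ha.1 b hab).symm
    have hbP : b ∉ P := fun hbP => ha.2 (hcl b hbP a (Or.inr ha.1) hab.symm)
    exact ⟨hb.resolve_left fun e => hbP (e ▸ hcP), hbP⟩
  refine ⟨A, c, hA, hc, hAc, hAc.isCutVertex hG hwA hwc, fun a ha hcut => ?_, hconn, ?_, ?_⟩
  · obtain ⟨P, P', hP, hP', hdis, -⟩ := hcut.exists_isPendant (w := c)
      (fun e => hAc.2.1 (e ▸ ha))
    have aux : ∀ P, IsPendant G P a → c ∉ P → False := by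
      intro P hP hcP
      have hPA : P ⊆ A := by
        intro v hv
        by_contra hvA
        have := hclosed (P \ A) ⟨v, hv, hvA⟩ (fun x hx b hxb => ?_) a
        · exact this.2 ha
        · have hbA : b ∉ A := fun hb =>
            (hAc.2.2 b hb x hxb.symm).elim hx.2 fun e => hcP (e ▸ hx.1)
          exact ⟨(hP.2.2 x hx.1 b hxb).resolve_right fun e => hbA (e ▸ ha), hbA⟩
      exact hP.2.1 (hmin' P a hPA (Or.inr ha) hP ▸ ha)
    by_cases hcP : c ∈ P
    · exact aux P' hP' fun h => Set.disjoint_left.1 hdis hcP h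
    · exact aux P hP hcP
  · refine (noOwnCutVertex_iff hconn).2 fun v hv => ?_
    by_contra hcon
    rw [induce_connected_iff] at hcon
    push Not at hcon
    obtain ⟨P, hP, hne, hcl, hnot⟩ := hcon (by
      obtain ⟨a, ha⟩ := hAc.1
      by_cases hvc : v = c
      · exact ⟨a, Or.inr ha, fun e => hAc.2.1 (hvc ▸ e ▸ ha)⟩
      · exact ⟨c, Or.inl rfl, fun e => hvc e.symm⟩)
    obtain ⟨t, ht, htP⟩ := Set.not_subset.1 hnot
    have aux : ∀ Q ⊆ insert c A \ {v}, Q.Nonempty → c ∉ Q → (∀ a ∈ Q, ∀ b ∈ insert c A \ {v},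
        G.Adj a b → b ∈ Q) → Q = A := by
      intro Q hQ hne hcQ hcl
      have hQA : Q ⊆ A := fun q hq => (hQ hq).1.resolve_left fun e => hcQ (e ▸ hq)
      refine hmin' Q v hQA hv ⟨hne, fun h => (hQ h).2 rfl, fun a ha b hab => ?_⟩
      by_cases hbv : b = v
      · exact Or.inr hbv
      · exact Or.inl (hcl a ha b ⟨(hAc.2.2 a (hQA ha) b hab).symm, hbv⟩ hab)
    have hPA : c ∉ P → P = A := fun h => aux P hP hne h hcl
    have hPA' : c ∉ (insert c A \ {v}) \ P → (insert c A \ {v}) \ P = A := fun h =>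
      aux _ Set.sdiff_subset ⟨t, ht, htP⟩ h fun a ha b hb hab =>
        ⟨hb, fun hbP => ha.2 (hcl b hbP a ha.1 hab.symm)⟩
    have hvA : ∀ Q : Set V, Q = A → v ∉ Q → v = c := fun Q hQ hvQ =>
      hv.resolve_right fun h => hvQ (hQ ▸ h)
    by_cases hcP : c ∈ P
    · have h1 := hPA' fun h => h.2 hcP
      have h2 := hvA _ h1 fun h => h.1.2 rfl
      exact (hP hcP).2 h2.symm
    · have h1 := hPA hcP
      have h2 := hvA _ h1 fun h => (hP h).2 rfl
      exact htP (h1 ▸ ht.1.resolve_left fun e => ht.2 (e.trans h2.symm))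
  · intro B hB hBc hBn
    refine Set.Subset.antisymm (fun b hb => ?_) hB
    by_contra hbA
    have hcB := hB (Or.inl rfl)
    have := (induce_connected_iff.1 ((noOwnCutVertex_iff hBc).1 hBn c hcB)).2 A
      (fun a ha => ⟨hB (Or.inr ha), fun e => hAc.2.1 (e ▸ ha)⟩) hAc.1
      (fun a ha x hx hax => (hAc.2.2 a ha x hax).resolve_right hx.2)
    exact hbA (Or.inr (this ⟨hb, fun e => hbA (Or.inl e)⟩))

/-- If a connected dominating set has at most one vertex in a pendant set, then this vertex
together with the cut vertex dominates the pendant set. -/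
theorem IsPendant.exists_isPendantDom {G : SimpleGraph V} {A D : Set V} {c : V}
    (hA : IsPendant G A c) (hD : IsCDS G D) (hc : c ∈ D) (hsub : (D ∩ A).Subsingleton) :
    ∃ T x, IsPendantDom G A T c x := by
  by_cases hall : ∀ v ∈ A, G.Adj c v
  · obtain ⟨x, hx⟩ := hA.1
    exact ⟨∅, x, hA, hx, Or.inl ⟨rfl, hall⟩⟩
  push Not at hall
  obtain ⟨x, hx, hcx⟩ := hall
  have hdom : ∀ v ∈ A, G.Adj c v ∨ v ∈ D ∨ ∃ u ∈ D ∩ A, G.Adj u v := by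
    intro v hv
    rcases hD.1 v with h | ⟨u, hu, huv⟩
    · exact Or.inr (Or.inl h)
    · rcases hA.2.2 v hv u huv.symm with h | rfl
      · exact Or.inr (Or.inr ⟨u, ⟨hu, h⟩, huv⟩)
      · exact Or.inl huv
  obtain ⟨t, htD, htA⟩ : (D ∩ A).Nonempty := by
    rcases hdom x hx with h | h | ⟨u, hu, -⟩
    · exact absurd h hcx
    · exact ⟨x, h, hx⟩
    · exact ⟨u, hu⟩
  refine ⟨{t}, x, hA, hx, Or.inr ⟨t, htA, rfl, ?_, hcx, fun v hv => ?_⟩⟩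
  · by_contra hct
    have := (induce_connected_iff.1 hD.2).2 (D ∩ A) Set.inter_subset_left ⟨t, htD, htA⟩
      (fun a ha b hb hab => ?_) hc
    · exact hA.2.1 this.2
    · obtain rfl := hsub ha ⟨htD, htA⟩
      exact ⟨hb, (hA.2.2 a htA b hab).resolve_right fun e => hct (e ▸ hab.symm)⟩
  · rcases hdom v hv with h | h | ⟨u, hu, huv⟩
    · exact Or.inr (Or.inr h)
    · exact Or.inl (hsub ⟨h, hv⟩ ⟨htD, htA⟩)
    · exact Or.inr (Or.inl (hsub hu ⟨htD, htA⟩ ▸ huv))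

/-- In a critical graph with a cut vertex, some end block contains at least two vertices of a
given `γc`-set that are not cut vertices. -/
theorem IsCritical.exists_endBlock [Finite V] {G : SimpleGraph V} {k : ℕ} (hk : 4 ≤ k)
    (hcrit : IsCritical G k) {D : Set V} (hD : IsGammaCSet G D) {c₀ : V}
    (hc₀ : c₀ ∈ cutVertices G) :
    ∃ A c, c ∈ cutVertices G ∧ (∀ a ∈ A, a ∉ cutVertices G) ∧ IsBlock G (insert c A) ∧
      1 < (D ∩ A).ncard := by
  have hG := hD.1.connected
  have hV : Nontrivial V := by
    by_contra hV
    rw [not_nontrivial_iff_subsingleton] at hV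
    have h1 := Set.ncard_le_card D
    have h2 := Finite.card_le_one_iff_subsingleton.2 hV
    have := hD.2
    have := hcrit.1
    omega
  obtain ⟨w, hw⟩ := exists_ne c₀
  obtain ⟨A₁, A₂, hA₁, hA₂, hdis, -⟩ := hc₀.exists_isPendant hw
  have hdis' := Set.disjoint_left.1 hdis
  obtain ⟨w₁, hw₁⟩ := hA₁.1
  obtain ⟨w₂, hw₂⟩ := hA₂.1
  obtain ⟨A, c, hA, hcA, hAc, hc, hAC, hAB⟩ := hA₁.exists_endBlock hG
    (fun h => hdis' h hw₂) (fun e => hA₂.2.1 (e ▸ hw₂))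
  obtain ⟨A', c', hA', hcA', hAc', hc', hAC', hAB'⟩ := hA₂.exists_endBlock hG
    (fun h => hdis' hw₁ h) (fun e => hA₁.2.1 (e ▸ hw₁))
  by_contra hcon
  push Not at hcon
  have hCD := cutVertices_subset_of_isCDS hD.1 hV
  have h1 := hcon A c hc hAC hAB
  have h2 := hcon A' c' hc' hAC' hAB'
  rw [Set.ncard_le_one_iff_subsingleton] at h1 h2
  obtain ⟨T, x, hT⟩ := hAc.exists_isPendantDom hD.1 (hCD hc) h1
  obtain ⟨T', y, hT'⟩ := hAc'.exists_isPendantDom hD.1 (hCD hc') h2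
  have hcA'' : c ∉ A' := fun h => hAC' c h hc
  have hcA''' : c' ∉ A := fun h => hAC c' h hc'
  have hdisA : Disjoint A A' := hdis.mono hA hA'
  have hxy : x ≠ y := fun e => Set.disjoint_left.1 hdisA hT.mem (e ▸ hT'.mem)
  have hnadj : ¬ G.Adj x y := fun h => (hAc.2.2 x hT.mem y h).elim
    (fun h => Set.disjoint_left.1 hdisA h hT'.mem) (fun e => hcA'' (e ▸ hT'.mem))
  have hpair : IsPendantPair G (addEdge G x y) A A' T T' c c' x y :=
    ⟨hG, hT, hT', hdisA, hcA'', hcA''', fun a b => by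
      simp only [addEdge, SimpleGraph.sup_adj, SimpleGraph.fromEdgeSet_adj,
        Set.mem_singleton_iff, Sym2.eq_iff]
      have := hxy
      grind⟩
  have h3 := hpair.connDomNum_le
  have h4 := hcrit.2 x y hxy hnadj
  have h5 := hcrit.1
  omega

/-- Let `G` be `k`-`γc`-critical (`k ≥ 4`) with exactly `k - 3` cut
vertices and `γc`-set `D`.  Then every cut vertex lies in `D`, `|D \ C(G)| = 3`, and
exactly one of the following holds: (a) some end block `B` has
`|(D ∩ V(B)) \ C(G)| = 3` and all other blocks have no vertex of `D` outside `C(G)`;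
(b) some end block `B` has `|(D ∩ V(B)) \ C(G)| = 2`, one block `B' ≠ B` has
`|(D ∩ V(B')) \ C(G)| = 1`, and every remaining block has no vertex of `D` outside
`C(G)`. -/
theorem statement11 (k : ℕ) (hk : 4 ≤ k) (V : Type) [Fintype V] (G : SimpleGraph V)
    (hcrit : IsCritical G k) (hcut : (cutVertices G).ncard = k - 3)
    (D : Set V) (hD : IsGammaCSet G D) :
    cutVertices G ⊆ D ∧ (D \ cutVertices G).ncard = 3 ∧
    Xor'
      (∃ B : Set V, IsBlock G B ∧ (B ∩ cutVertices G).ncard = 1 ∧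
        ((D ∩ B) \ cutVertices G).ncard = 3 ∧
        ∀ B' : Set V, IsBlock G B' → B' ≠ B →
          ((D ∩ B') \ cutVertices G).ncard = 0)
      (∃ B B' : Set V, IsBlock G B ∧ (B ∩ cutVertices G).ncard = 1 ∧
        ((D ∩ B) \ cutVertices G).ncard = 2 ∧
        IsBlock G B' ∧ B' ≠ B ∧ ((D ∩ B') \ cutVertices G).ncard = 1 ∧
        ∀ B'' : Set V, IsBlock G B'' → B'' ≠ B → B'' ≠ B' →
          ((D ∩ B'') \ cutVertices G).ncard = 0) := by
  obtain ⟨c₀, hc₀⟩ : (cutVertices G).Nonempty := by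
    rw [← Set.ncard_pos (Set.toFinite _)]
    omega
  have hG := hD.1.connected
  have hcardD := hD.2.trans hcrit.1
  have hV : Nontrivial V := by
    obtain ⟨a, -, b, -, hab⟩ := (Set.one_lt_ncard_iff_nontrivial (s := D)).1 (by omega)
    exact ⟨a, b, hab⟩
  have hCD := cutVertices_subset_of_isCDS hD.1 hV
  have hcard3 : (D \ cutVertices G).ncard = 3 := by
    rw [Set.ncard_sdiff hCD (Set.toFinite _)]
    omega
  refine ⟨hCD, hcard3, ?_⟩
  obtain ⟨A, c, hc, hAC, hB, hcard⟩ := hcrit.exists_endBlock hk hD hc₀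
  have hBC : (insert c A ∩ cutVertices G).ncard = 1 := by
    rw [Set.ncard_eq_one]
    refine ⟨c, Set.ext fun v => ⟨fun ⟨h1, h2⟩ => h1.resolve_right fun h => hAC v h h2, ?_⟩⟩
    rintro rfl
    exact ⟨Or.inl rfl, hc⟩
  have hDA : (D ∩ insert c A) \ cutVertices G = D ∩ A := by
    ext v
    constructor
    · rintro ⟨⟨h1, rfl | h2⟩, h3⟩
      · exact absurd hc h3
      · exact ⟨h1, h2⟩
    · exact fun h => ⟨⟨h.1, Or.inr h.2⟩, hAC v h.2⟩
  have hsub : D ∩ A ⊆ D \ cutVertices G := fun v hv => ⟨hv.1, hAC v hv.2⟩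
  have huniq : ∀ {B B' : Set V} {v : V}, IsBlock G B → IsBlock G B' → v ∉ cutVertices G →
      v ∈ B → v ∈ B' → B = B' := fun h h' hv hvB hvB' =>
    (h.eq_blockAt hG hv hvB).trans (h'.eq_blockAt hG hv hvB').symm
  refine (xor_iff_or_and_not_and _ _).2 ?_
  constructor
  · by_cases h3 : (D ∩ A).ncard = 3
    · left
      refine ⟨insert c A, hB, hBC, hDA ▸ h3, fun B' hB' hne => ?_⟩
      have heq := Set.eq_of_subset_of_ncard_le hsub (by omega) (Set.toFinite _)
      rw [Set.ncard_eq_zero (Set.toFinite _), Set.eq_empty_iff_forall_notMem]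
      rintro v ⟨⟨hvD, hvB⟩, hvC⟩
      have hvA : v ∈ D ∩ A := heq ▸ ⟨hvD, hvC⟩
      exact hne (huniq hB' hB hvC hvB (Or.inr hvA.2))
    · right
      have hle := Set.ncard_le_ncard hsub (Set.toFinite _)
      have hone : ((D \ cutVertices G) \ (D ∩ A)).ncard = 1 := by
        rw [Set.ncard_sdiff hsub (Set.toFinite _)]
        omega
      obtain ⟨t, ht⟩ := Set.ncard_eq_one.1 hone
      have htmem : t ∈ (D \ cutVertices G) \ (D ∩ A) := ht ▸ rfl
      have hcase : ∀ v ∈ D, v ∉ cutVertices G → v ∈ A ∨ v = t := by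
        intro v hvD hvC
        by_cases hvA : v ∈ A
        · exact Or.inl hvA
        · exact Or.inr (ht.subset ⟨⟨hvD, hvC⟩, fun h => hvA h.2⟩)
      have htB := isBlock_blockAt hG htmem.1.2
      have htself := mem_blockAt_self G t
      have hneB : blockAt G t ≠ insert c A := by
        intro e
        rcases e ▸ htself with h | h
        · exact htmem.1.2 (h ▸ hc)
        · exact htmem.2 ⟨htmem.1.1, h⟩
      refine ⟨insert c A, blockAt G t, hB, hBC, by rw [hDA]; omega, htB, hneB, ?_, ?_⟩
      · refine Set.ncard_eq_one.2 ⟨t, Set.ext fun v => ⟨?_, ?_⟩⟩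
        · rintro ⟨⟨hvD, hvB⟩, hvC⟩
          refine (hcase v hvD hvC).resolve_left fun hvA => ?_
          exact hneB (huniq htB hB hvC hvB (Or.inr hvA))
        · rintro rfl
          exact ⟨⟨htmem.1.1, htself⟩, htmem.1.2⟩
      · intro B hB' hne hne'
        rw [Set.ncard_eq_zero (Set.toFinite _), Set.eq_empty_iff_forall_notMem]
        rintro v ⟨⟨hvD, hvB⟩, hvC⟩
        rcases hcase v hvD hvC with hvA | rfl
        · exact hne (huniq hB' hB hvC hvB (Or.inr hvA))
        · exact hne' (huniq hB' htB hvC hvB htself)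
  · rintro ⟨⟨B, -, -, h3, hrest⟩, B₁, B₂, hB₁, -, h2, -⟩
    by_cases h : B₁ = B
    · rw [h] at h2
      omega
    · have := hrest B₁ hB₁ h
      omega
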